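/- For n > 1, the number of separable d-permutations of [n] equals (1/(n-1))·∑_{k=0}^{n-2} C(n-1,k)·C(n-1,k+1)·(2^(d-1) − 1)^k·(2^(d-1))^(n-k-1). -/

import Mathlib

/-- `P` is a `d`-permutation: a sequence of `d` permutations of `[n]`
whose first entry is the identity. -/
def IsDPerm {d n : ℕ} (P : Fin d → Equiv.Perm (Fin n)) : Prop :=
  ∀ h : 0 < d, P ⟨0, h⟩ = 1

/-- Separability of the restriction of the `d` rows `P` to the block of
columns `[a, b)`: either the block consists of a single column, or it can be
split into two consecutive sub-blocks such that in each row all entries of one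
sub-block are smaller than all entries of the other, and both sub-blocks are
themselves separable. -/
inductive SepOn {d : ℕ} (P : Fin d → ℕ → ℕ) : ℕ → ℕ → Prop
  | single (a : ℕ) : SepOn P a (a + 1)
  | split (a l b : ℕ) (h1 : a < l) (h2 : l < b)
      (hmono : ∀ i : Fin d,
        (∀ j1 j2, a ≤ j1 → j1 < l → l ≤ j2 → j2 < b → P i j1 < P i j2) ∨
        (∀ j1 j2, a ≤ j1 → j1 < l → l ≤ j2 → j2 < b → P i j2 < P i j1))
      (hL : SepOn P a l) (hR : SepOn P l b) : SepOn P a b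

/-- The rows of a `d`-permutation, as functions `ℕ → ℕ`. -/
def dPermRows {d n : ℕ} (P : Fin d → Equiv.Perm (Fin n)) : Fin d → ℕ → ℕ :=
  fun i j => if h : j < n then (P i ⟨j, h⟩ : ℕ) else 0

/-- A `d`-permutation of `[n]` is separable if its full block of columns is
recursively separable. -/
def IsSepDPerm {d n : ℕ} (P : Fin d → Equiv.Perm (Fin n)) : Prop :=
  SepOn (dPermRows P) 0 n

section Lagrange

open PowerSeries

/-- If `g` is invertible, the residue of `d(X g) / (X g) ^ (p + 1)` is `1` for `p = 0`
and `0` otherwise. -/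
theorem coeff_derivative_X_mul_mul_inv_pow (g : ℚ⟦X⟧) (hg : constantCoeff g ≠ 0) (p : ℕ) :
    coeff p (d⁄dX ℚ (X * g) * g⁻¹ ^ (p + 1)) = if p = 0 then 1 else 0 := by
  have hgi : g * g⁻¹ = 1 := PowerSeries.mul_inv_cancel g hg
  have hd : d⁄dX ℚ (X * g) = g + X * d⁄dX ℚ g := by
    simp [Derivation.leibniz, mul_comm]
  rw [hd]
  rcases p with _ | q
  · simp [hg]
  · have hpow : d⁄dX ℚ (g⁻¹ ^ (q + 1)) = -((q + 1 : ℕ) : ℚ⟦X⟧) * (g⁻¹ ^ (q + 2) * d⁄dX ℚ g) := by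
      rw [derivative_pow, derivative_inv', Nat.add_sub_cancel]
      ring
    have key : ((q + 1 : ℕ) : ℚ⟦X⟧) * ((g + X * d⁄dX ℚ g) * g⁻¹ ^ (q + 1 + 1)) =
        ((q + 1 : ℕ) : ℚ⟦X⟧) * g⁻¹ ^ (q + 1) - X * d⁄dX ℚ (g⁻¹ ^ (q + 1)) := by
      rw [hpow]
      linear_combination ((q + 1 : ℕ) : ℚ⟦X⟧) * g⁻¹ ^ (q + 1) * hgi
    have h2 := congrArg (coeff (q + 1)) key
    rw [map_sub, coeff_succ_X_mul, coeff_derivative, ← nsmul_eq_mul, ← nsmul_eq_mul,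
      map_nsmul, map_nsmul, nsmul_eq_mul, nsmul_eq_mul] at h2
    have h3 : ((q + 1 : ℕ) : ℚ) ≠ 0 := by positivity
    have h4 : ((q + 1 : ℕ) : ℚ) * coeff (q + 1) ((g + X * d⁄dX ℚ g) * g⁻¹ ^ (q + 1 + 1)) = 0 := by
      rw [h2]; push_cast; ring
    simpa using (mul_eq_zero.mp h4).resolve_left h3

/-- The formal change of variables `u = X g` in a residue. -/
theorem coeff_aeval_X_mul_mul_inv_pow (g : ℚ⟦X⟧) (hg : constantCoeff g ≠ 0) (n : ℕ)
    (f : Polynomial ℚ) :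
    coeff n (Polynomial.aeval (X * g) f * (d⁄dX ℚ (X * g) * g⁻¹ ^ (n + 1))) = f.coeff n := by
  have hgi : g * g⁻¹ = 1 := PowerSeries.mul_inv_cancel g hg
  induction f using Polynomial.induction_on' with
  | add p q hp hq => rw [map_add, add_mul, map_add, hp, hq, Polynomial.coeff_add]
  | monomial j a =>
    rw [Polynomial.aeval_monomial, Polynomial.coeff_monomial]
    have h1 : algebraMap ℚ ℚ⟦X⟧ a * (X * g) ^ j * (d⁄dX ℚ (X * g) * g⁻¹ ^ (n + 1)) =
        C a * ((g ^ j * (d⁄dX ℚ (X * g) * g⁻¹ ^ (n + 1))) * X ^ j) := by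
      rw [PowerSeries.algebraMap_apply, Algebra.algebraMap_self_apply]
      ring
    rw [h1, coeff_C_mul, coeff_mul_X_pow']
    by_cases hj : j ≤ n
    · obtain ⟨p, rfl⟩ := Nat.exists_eq_add_of_le hj
      have h2 : g ^ j * (d⁄dX ℚ (X * g) * g⁻¹ ^ (j + p + 1)) =
          d⁄dX ℚ (X * g) * g⁻¹ ^ (p + 1) := by
        calc _ = (g * g⁻¹) ^ j * (d⁄dX ℚ (X * g) * g⁻¹ ^ (p + 1)) := by ring
          _ = _ := by rw [hgi, one_pow, one_mul]
      rw [if_pos hj, h2, Nat.add_sub_cancel_left, coeff_derivative_X_mul_mul_inv_pow g hg]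
      by_cases hp : p = 0 <;> simp [hp]
    · rw [if_neg hj, if_neg (by omega), mul_zero]

/-- **Lagrange inversion** for `F = X φ(F)` with `φ` a polynomial. -/
theorem lagrange_inversion (φ : Polynomial ℚ) (F : ℚ⟦X⟧)
    (hF : F = X * Polynomial.aeval F φ) (hφ : φ.coeff 0 ≠ 0) (n : ℕ) :
    ((n : ℚ) + 1) * coeff (n + 1) F = (φ ^ (n + 1)).coeff n := by
  obtain ⟨g, hg⟩ : ∃ g, g = Polynomial.aeval F φ := ⟨_, rfl⟩
  rw [← hg] at hF
  have hF0 : constantCoeff F = 0 := by rw [hF]; simp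
  have hg0 : constantCoeff g ≠ 0 := by
    have : constantCoeff g = Polynomial.eval (constantCoeff F) φ := by
      rw [hg, Polynomial.aeval_def, Polynomial.hom_eval₂, Polynomial.eval]
      congr 1
    rwa [this, hF0, ← Polynomial.coeff_zero_eq_eval_zero]
  have hgi : g * g⁻¹ = 1 := PowerSeries.mul_inv_cancel g hg0
  rw [← coeff_aeval_X_mul_mul_inv_pow g hg0, ← hF, map_pow, ← hg, mul_left_comm, ← mul_pow, hgi,
    one_pow, mul_one, coeff_derivative, mul_comm]

end Lagrange

/-- The generating function equation `F = X (1 + F) (q + 1 + q F)` for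
`F = ∑_{n ≥ 1} B n X ^ n`, solved explicitly. -/
theorem explicit_of_recurrence (q : ℕ) (B : ℕ → ℚ) (h0 : B 0 = 1)
    (hB : ∀ n, B (n + 1) = B n + q * ∑ p ∈ Finset.range (n + 1), B p * B (n - p)) (n : ℕ) :
    B (n + 1) = 1 / ((n : ℚ) + 1) * ∑ k ∈ Finset.range (n + 1),
      ((n + 1).choose k : ℚ) * ((n + 1).choose (k + 1) : ℚ) * (q : ℚ) ^ k *
        ((q : ℚ) + 1) ^ (n + 1 - k) := by
  let G : PowerSeries ℚ := PowerSeries.mk B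
  have hG : G = 1 + PowerSeries.X * (G + PowerSeries.C (q : ℚ) * (G * G)) := by
    ext m
    rcases m with _ | m
    · simp [G, h0]
    · rw [map_add, PowerSeries.coeff_succ_X_mul, map_add, PowerSeries.coeff_C_mul,
        PowerSeries.coeff_mul, Finset.Nat.sum_antidiagonal_eq_sum_range_succ_mk]
      simp [G, hB, PowerSeries.coeff_one]
  let φ : Polynomial ℚ := (1 + Polynomial.X) *
    (Polynomial.C ((q : ℚ) + 1) + Polynomial.C (q : ℚ) * Polynomial.X)
  have hF : G - 1 = PowerSeries.X * Polynomial.aeval (G - 1) φ := by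
    simp only [φ, map_mul, map_add, map_one, Polynomial.aeval_X, Polynomial.aeval_C]
    rw [PowerSeries.algebraMap_apply, Algebra.algebraMap_self_apply]
    simp only [map_natCast] at hG ⊢
    linear_combination hG
  have hL := lagrange_inversion φ (G - 1) hF (by simp [φ, Polynomial.mul_coeff_zero]; positivity) n
  have hcoeff : PowerSeries.coeff (n + 1) (G - 1) = B (n + 1) := by
    simp [G, PowerSeries.coeff_one]
  have hpow : (φ ^ (n + 1)).coeff n = ∑ k ∈ Finset.range (n + 1),
      ((n + 1).choose k : ℚ) * ((n + 1).choose (k + 1) : ℚ) * (q : ℚ) ^ k *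
        ((q : ℚ) + 1) ^ (n + 1 - k) := by
    have hlin (m k : ℕ) : ((Polynomial.C ((q : ℚ) + 1) + Polynomial.C (q : ℚ) *
        Polynomial.X) ^ m).coeff k = (m.choose k : ℚ) * (q : ℚ) ^ k * ((q : ℚ) + 1) ^ (m - k) := by
      have h : (Polynomial.C ((q : ℚ) + 1) + Polynomial.C (q : ℚ) * Polynomial.X) ^ m =
          ((Polynomial.X + Polynomial.C ((q : ℚ) + 1)) ^ m).comp
            (Polynomial.C (q : ℚ) * Polynomial.X) := by
        simp [add_comm]
      rw [h, Polynomial.comp_C_mul_X_coeff, Polynomial.coeff_X_add_C_pow]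
      ring
    rw [mul_pow, mul_comm, Polynomial.coeff_mul,
      Finset.Nat.sum_antidiagonal_eq_sum_range_succ_mk]
    refine Finset.sum_congr rfl fun k hk => ?_
    have hk' : k ≤ n := Nat.lt_succ_iff.mp (Finset.mem_range.mp hk)
    have hs : (n + 1).choose (n - k) = (n + 1).choose (k + 1) :=
      Nat.choose_symm_of_eq_add (by omega)
    simp only [hlin, Polynomial.coeff_one_add_X_pow, hs]
    ring
  rw [← hpow, ← hL, hcoeff]
  field_simp

section Coloring

variable {K : Type*}

/-- Separability on `[a, b)` of a colouring `c` of the pairs `i < j`: either the block is a single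
point, or it splits into two separable sub-blocks with a constant colour across. -/
inductive SepColoring (c : ℕ → ℕ → K) : ℕ → ℕ → Prop
  | single (a : ℕ) : SepColoring c a (a + 1)
  | split (a l b : ℕ) (s : K) (hal : a < l) (hlb : l < b)
      (hs : ∀ i j, a ≤ i → i < l → l ≤ j → j < b → c i j = s)
      (hL : SepColoring c a l) (hR : SepColoring c l b) : SepColoring c a b

namespace SepColoring

variable {c c' : ℕ → ℕ → K} {a b l : ℕ}

theorem congr (h : SepColoring c a b)
    (hc : ∀ i j, a ≤ i → i < j → j < b → c i j = c' i j) : SepColoring c' a b := by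
  induction h with
  | single a => exact single a
  | split a l b s hal hlb hs hL hR ihL ihR =>
    refine split a l b s hal hlb (fun i j h1 h2 h3 h4 => ?_)
      (ihL fun i j h1 h2 h3 => hc i j h1 h2 (by omega))
      (ihR fun i j h1 h2 h3 => hc i j (by omega) h2 h3)
    rw [← hc i j h1 (by omega) h4, hs i j h1 h2 h3 h4]

theorem subinterval (h : SepColoring c a b) :
    ∀ a' b', a ≤ a' → a' < b' → b' ≤ b → SepColoring c a' b' := by
  induction h with
  | single a =>
    intro a' b' h1 h2 h3
    obtain ⟨rfl, rfl⟩ : a' = a ∧ b' = a' + 1 := by omega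
    exact single a'
  | split a l b s hal hlb hs hL hR ihL ihR =>
    intro a' b' h1 h2 h3
    by_cases hb : b' ≤ l
    · exact ihL a' b' h1 h2 hb
    by_cases ha : l ≤ a'
    · exact ihR a' b' ha h2 h3
    exact split a' l b' s (by omega) (by omega)
      (fun i j h4 h5 h6 h7 => hs i j (by omega) h5 h6 (by omega))
      (ihL a' l h1 (by omega) le_rfl) (ihR l b' le_rfl (by omega) h3)

end SepColoring

/-- `l` is the first point at which `[a, b)` can be split: the left block is a single point or has
a different top colour. -/
structure IsFirstSplit (c : ℕ → ℕ → K) (a l b : ℕ) : Prop where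
  lt_left : a < l
  lt_right : l < b
  color_eq : ∀ i j, a ≤ i → i < l → l ≤ j → j < b → c i j = c a (b - 1)
  left : SepColoring c a l
  right : SepColoring c l b
  color_ne : a + 1 < l → c a (l - 1) ≠ c a (b - 1)

variable {c : ℕ → ℕ → K} {a b l l' : ℕ}

theorem IsFirstSplit.sepColoring (h : IsFirstSplit c a l b) : SepColoring c a b :=
  .split a l b _ h.lt_left h.lt_right h.color_eq h.left h.right

theorem SepColoring.exists_split (h : SepColoring c a b) (hab : a + 1 < b) :
    ∃ l, a < l ∧ l < b ∧ ∀ i j, a ≤ i → i < l → l ≤ j → j < b → c i j = c a (b - 1) := by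
  cases h with
  | single => omega
  | split _ l _ s hal hlb hs hL hR =>
    refine ⟨l, hal, hlb, fun i j h1 h2 h3 h4 => ?_⟩
    rw [hs i j h1 h2 h3 h4, hs a (b - 1) le_rfl hal (by omega) (by omega)]

theorem SepColoring.exists_isFirstSplit (h : SepColoring c a b) (hab : a + 1 < b) :
    ∃ l, IsFirstSplit c a l b := by
  classical
  have hex := h.exists_split hab
  obtain ⟨h1, h2, h3⟩ := Nat.find_spec hex
  have hmin := fun m => Nat.find_min hex (m := m)
  generalize Nat.find hex = l at h1 h2 h3 hmin
  have hL := h.subinterval a l le_rfl h1 h2.le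
  refine ⟨l, h1, h2, h3, hL, h.subinterval l b h1.le h2 le_rfl, fun hal heq => ?_⟩
  obtain ⟨m, hm1, hm2, hm3⟩ := hL.exists_split hal
  refine hmin m hm2 ⟨hm1, hm2.trans h2, fun i j h4 h5 h6 h7 => ?_⟩
  by_cases hj : j < l
  · rw [hm3 i j h4 h5 h6 hj, heq]
  · exact h3 i j h4 (by omega) (by omega) h7

theorem IsFirstSplit.le (h : IsFirstSplit c a l b) (h' : IsFirstSplit c a l' b) : l' ≤ l := by
  by_contra! hlt
  have := h.lt_left
  have := h'.lt_right
  exact h'.color_ne (by omega) (h.color_eq a (l' - 1) le_rfl (by omega) (by omega) (by omega))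

theorem IsFirstSplit.unique (h : IsFirstSplit c a l b) (h' : IsFirstSplit c a l' b) : l = l' :=
  le_antisymm (h'.le h) (h.le h')

variable (K) [Inhabited K]

/-- The separable colourings of `[a, b)`, normalised to be `default` elsewhere. -/
def sepColorings (a b : ℕ) : Set (ℕ → ℕ → K) :=
  {c | SepColoring c a b ∧ ∀ i j, ¬(a ≤ i ∧ i < j ∧ j < b) → c i j = default}

variable {K}

/-- Restriction of a colouring to the pairs in `[a, b)`. -/
def restrictColoring (c : ℕ → ℕ → K) (a b i j : ℕ) : K :=
  if a ≤ i ∧ i < j ∧ j < b then c i j else default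

theorem restrictColoring_of_mem (c : ℕ → ℕ → K) {i j : ℕ} (h1 : a ≤ i) (h2 : i < j) (h3 : j < b) :
    restrictColoring c a b i j = c i j := if_pos ⟨h1, h2, h3⟩

theorem SepColoring.restrictColoring_mem (h : SepColoring c a b) :
    restrictColoring c a b ∈ sepColorings K a b :=
  ⟨h.congr fun _ _ h1 h2 h3 => (restrictColoring_of_mem c h1 h2 h3).symm, fun _ _ h => if_neg h⟩

/-- The colouring of `[a, b)` that agrees with `c₁` on `[a, l)`, with `c₂` on `[l, b)`, and has
colour `s` across. -/
def glueColoring (a l b : ℕ) (c₁ c₂ : ℕ → ℕ → K) (s : K) (i j : ℕ) : K :=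
  if a ≤ i ∧ i < j ∧ j < b then
    if j < l then c₁ i j else if l ≤ i then c₂ i j else s
  else default

theorem isFirstSplit_glueColoring {c₁ c₂ : ℕ → ℕ → K} {s : K} (hal : a < l) (hlb : l < b)
    (h₁ : SepColoring c₁ a l) (h₂ : SepColoring c₂ l b) (hs : a + 1 < l → c₁ a (l - 1) ≠ s) :
    IsFirstSplit (glueColoring a l b c₁ c₂ s) a l b := by
  have hcross : ∀ i j, a ≤ i → i < l → l ≤ j → j < b → glueColoring a l b c₁ c₂ s i j = s := by
    intro i j h1 h2 h3 h4
    rw [glueColoring, if_pos (by omega), if_neg (by omega), if_neg (by omega)]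
  have htop := hcross a (b - 1) le_rfl hal (by omega) (by omega)
  have hleft : ∀ i j, a ≤ i → i < j → j < l → c₁ i j = glueColoring a l b c₁ c₂ s i j := by
    intro i j h1 h2 h3
    rw [glueColoring, if_pos (by omega), if_pos h3]
  refine ⟨hal, hlb, fun i j h1 h2 h3 h4 => ?_, h₁.congr hleft, h₂.congr fun i j h1 h2 h3 => ?_,
    fun h => ?_⟩
  · rw [hcross i j h1 h2 h3 h4, htop]
  · rw [glueColoring, if_pos (by omega), if_neg (by omega), if_pos h1]
  · rw [htop, ← hleft a (l - 1) le_rfl (by omega) (by omega)]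
    exact hs h

theorem glueColoring_mem {c₁ c₂ : ℕ → ℕ → K} {s : K} (hal : a < l) (hlb : l < b)
    (h₁ : SepColoring c₁ a l) (h₂ : SepColoring c₂ l b) (hs : a + 1 < l → c₁ a (l - 1) ≠ s) :
    glueColoring a l b c₁ c₂ s ∈ sepColorings K a b :=
  ⟨(isFirstSplit_glueColoring hal hlb h₁ h₂ hs).sepColoring, fun _ _ h => if_neg h⟩

/-- The data of a separable colouring of `[a, a + n + 2)`: its first split point `a + p + 1`, the
two sub-blocks and the colour across. -/
abbrev FirstSplitData (K : Type*) [Inhabited K] (a n : ℕ) : Type _ :=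
  Σ p : Fin (n + 1), Σ c₁ : sepColorings K a (a + p + 1),
    sepColorings K (a + p + 1) (a + n + 2) × {s : K // a + 1 < a + p + 1 → c₁.1 a (a + p) ≠ s}

theorem card_sepColorings_eq_card_firstSplitData (a n : ℕ) :
    Nat.card (sepColorings K a (a + n + 2)) = Nat.card (FirstSplitData K a n) := by
  symm
  let f : FirstSplitData K a n → sepColorings K a (a + n + 2) := fun x =>
    ⟨glueColoring a (a + x.1 + 1) (a + n + 2) x.2.1.1 x.2.2.1.1 x.2.2.2.1,
      glueColoring_mem (by omega) (by omega) x.2.1.2.1 x.2.2.1.2.1 x.2.2.2.2⟩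
  refine Nat.card_congr (Equiv.ofBijective f ⟨?_, ?_⟩)
  · rintro ⟨p, ⟨c₁, h₁⟩, ⟨c₂, h₂⟩, ⟨s, hs⟩⟩ ⟨p', ⟨c₁', h₁'⟩, ⟨c₂', h₂'⟩, ⟨s', hs'⟩⟩ heq
    have hg : glueColoring a (a + p + 1) (a + n + 2) c₁ c₂ s =
        glueColoring a (a + p' + 1) (a + n + 2) c₁' c₂' s' := congrArg Subtype.val heq
    have hF := isFirstSplit_glueColoring (b := a + n + 2) (by omega) (by omega) h₁.1 h₂.1 hs
    have hF' := isFirstSplit_glueColoring (b := a + n + 2) (by omega) (by omega) h₁'.1 h₂'.1 hs'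
    rw [hg] at hF
    obtain rfl : p = p' := Fin.ext (by have := hF.unique hF'; omega)
    have hg' := fun i j => congrFun (congrFun hg i) j
    simp only [glueColoring] at hg'
    obtain rfl : c₁ = c₁' := by
      ext i j
      by_cases h : a ≤ i ∧ i < j ∧ j < a + p + 1
      · have := hg' i j
        rwa [if_pos (by omega), if_pos (by omega), if_pos (by omega), if_pos (by omega)] at this
      · rw [h₁.2 i j h, h₁'.2 i j h]
    obtain rfl : c₂ = c₂' := by
      ext i j
      by_cases h : a + p + 1 ≤ i ∧ i < j ∧ j < a + n + 2
      · have := hg' i j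
        rwa [if_pos (by omega), if_neg (by omega), if_pos (by omega), if_pos (by omega),
          if_neg (by omega), if_pos (by omega)] at this
      · rw [h₂.2 i j h, h₂'.2 i j h]
    obtain rfl : s = s' := by
      have := hg' a (a + n + 1)
      rwa [if_pos (by omega), if_neg (by omega), if_neg (by omega), if_pos (by omega),
          if_neg (by omega), if_neg (by omega)] at this
    rfl
  · rintro ⟨c, hc, hsupp⟩
    obtain ⟨l, hl⟩ := hc.exists_isFirstSplit (by omega)
    have hal := hl.lt_left
    have hlb := hl.lt_right
    obtain ⟨p, rfl⟩ : ∃ p, l = a + p + 1 := ⟨l - a - 1, by omega⟩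
    refine ⟨⟨⟨p, by omega⟩, ⟨_, hl.left.restrictColoring_mem⟩, ⟨_, hl.right.restrictColoring_mem⟩,
      ⟨c a (a + n + 1), fun h => ?_⟩⟩, ?_⟩
    · have h' : a + 1 < a + p + 1 := h
      change restrictColoring c a (a + p + 1) a (a + p) ≠ _
      rw [restrictColoring_of_mem c le_rfl (by omega) (by omega)]
      exact hl.color_ne h
    · refine Subtype.ext ?_
      ext i j
      simp only [f, glueColoring]
      split_ifs with h1 h2 h3
      · exact restrictColoring_of_mem c h1.1 h1.2.1 h2
      · exact restrictColoring_of_mem c h3 h1.2.1 h1.2.2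
      · exact (hl.color_eq i j h1.1 (by omega) (by omega) h1.2.2).symm
      · exact (hsupp i j h1).symm

instance finite_sepColorings [Finite K] (a b : ℕ) : Finite (sepColorings K a b) := by
  refine Finite.of_injective
    (fun (c : sepColorings K a b) (i j : Fin b) => c.1 i j) fun c c' h => Subtype.ext ?_
  ext i j
  by_cases hij : a ≤ i ∧ i < j ∧ j < b
  · exact congrFun (congrFun h ⟨i, by omega⟩) ⟨j, by omega⟩
  · rw [c.2.2 i j hij, c'.2.2 i j hij]

theorem card_sepColorings_single (a : ℕ) : Nat.card (sepColorings K a (a + 1)) = 1 := by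
  rw [Nat.card_eq_one_iff_unique]
  refine ⟨⟨fun c c' => Subtype.ext ?_⟩, ⟨⟨fun _ _ => default, .single a, fun _ _ _ => rfl⟩⟩⟩
  ext i j
  rw [c.2.2 i j (by omega), c'.2.2 i j (by omega)]

theorem card_sepColorings_rec [Finite K] (a n : ℕ) :
    Nat.card (sepColorings K a (a + n + 2)) = ∑ p ∈ Finset.range (n + 1),
      Nat.card (sepColorings K a (a + p + 1)) * (Nat.card (sepColorings K (a + p + 1) (a + n + 2)) *
        (Nat.card K - if p = 0 then 0 else 1)) := by
  have hK (p : ℕ) (t : K) : Nat.card {s : K // a + 1 < a + p + 1 → t ≠ s} =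
      Nat.card K - if p = 0 then 0 else 1 := by
    classical
    have := Fintype.ofFinite K
    split_ifs with hp
    · exact Nat.card_congr (Equiv.subtypeUnivEquiv fun s h => by omega)
    · rw [Nat.card_congr (Equiv.subtypeEquivRight (q := fun s => s ∈ ({t} : Finset K)ᶜ) fun s => by
        simp [Nat.one_le_iff_ne_zero.mpr hp, eq_comm])]
      rw [Nat.card_eq_fintype_card, Fintype.card_coe, Finset.card_compl, Finset.card_singleton,
        Nat.card_eq_fintype_card]
  rw [card_sepColorings_eq_card_firstSplitData, Nat.card_sigma, ← Fin.sum_univ_eq_sum_range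
    (fun p => Nat.card (sepColorings K a (a + p + 1)) *
      (Nat.card (sepColorings K (a + p + 1) (a + n + 2)) *
        (Nat.card K - if p = 0 then 0 else 1)))]
  refine Finset.sum_congr rfl fun p _ => ?_
  have := Fintype.ofFinite (sepColorings K a (a + p + 1))
  rw [Nat.card_sigma]
  simp only [Nat.card_prod, hK, Finset.sum_const, Finset.card_univ, smul_eq_mul,
    Nat.card_eq_fintype_card (α := sepColorings K a (a + p + 1))]

theorem card_sepColorings_translate [Finite K] (n : ℕ) :
    ∀ a, Nat.card (sepColorings K a (a + n + 1)) = Nat.card (sepColorings K 0 (n + 1)) := by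
  induction n using Nat.strong_induction_on with
  | _ n ih =>
    intro a
    rcases n with _ | n
    · simp only [add_zero, zero_add, card_sepColorings_single]
    · have h0 := card_sepColorings_rec (K := K) 0 n
      simp only [zero_add] at h0
      rw [show a + (n + 1) + 1 = a + n + 2 from rfl, show n + 1 + 1 = n + 2 from rfl,
        card_sepColorings_rec, h0]
      refine Finset.sum_congr rfl fun p hp => ?_
      have hp' := Finset.mem_range.mp hp
      have h1 := ih (n - p) (by omega) (a + p + 1)
      have h2 := ih (n - p) (by omega) (p + 1)
      rw [show a + p + 1 + (n - p) + 1 = a + n + 2 by omega] at h1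
      rw [show p + 1 + (n - p) + 1 = n + 2 by omega] at h2
      rw [ih p hp', h1, h2]

theorem card_sepColorings_recurrence [Finite K] (q : ℕ) (hq : Nat.card K = q + 1) (n : ℕ) :
    Nat.card (sepColorings K 0 (n + 2)) = Nat.card (sepColorings K 0 (n + 1)) +
      q * ∑ p ∈ Finset.range (n + 1),
        Nat.card (sepColorings K 0 (p + 1)) * Nat.card (sepColorings K 0 (n - p + 1)) := by
  have h0 := card_sepColorings_rec (K := K) 0 n
  simp only [zero_add] at h0
  have hsingle := card_sepColorings_single (K := K) 0
  rw [zero_add] at hsingle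
  rw [h0, Finset.mul_sum, Finset.sum_range_succ', Finset.sum_range_succ' _ n, hq]
  have htail (p : ℕ) (hp : p ≤ n) : Nat.card (sepColorings K (p + 1) (n + 2)) =
      Nat.card (sepColorings K 0 (n - p + 1)) := by
    rw [← card_sepColorings_translate (n - p) (p + 1)]
    congr 3
    omega
  have hsum : ∀ p ∈ Finset.range n, Nat.card (sepColorings K 0 (p + 1 + 1)) *
      (Nat.card (sepColorings K (p + 1 + 1) (n + 2)) * (q + 1 - if p + 1 = 0 then 0 else 1)) =
      q * (Nat.card (sepColorings K 0 (p + 1 + 1)) *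
        Nat.card (sepColorings K 0 (n - (p + 1) + 1))) := by
    intro p hp
    rw [htail (p + 1) (Finset.mem_range.mp hp), if_neg (Nat.succ_ne_zero p), Nat.add_sub_cancel]
    ring
  rw [Finset.sum_congr rfl hsum, htail 0 (Nat.zero_le n), if_pos rfl, zero_add, hsingle]
  simp only [Nat.sub_zero]
  ring

end Coloring

section Realization

/-- A permutation is determined by the order pattern of its values. -/
theorem Equiv.Perm.eq_of_lt_iff_lt {n : ℕ} {σ τ : Equiv.Perm (Fin n)}
    (h : ∀ i j, i < j → (σ i < σ j ↔ τ i < τ j)) : σ = τ := by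
  have h' : ∀ i j, σ i < σ j → τ i < τ j := by
    intro i j hij
    rcases lt_trichotomy i j with hlt | rfl | hlt
    · exact (h i j hlt).mp hij
    · exact absurd hij (lt_irrefl _)
    · have h1 : ¬τ j < τ i := fun h2 => lt_asymm hij ((h j i hlt).mpr h2)
      exact lt_of_le_of_ne (not_lt.mp h1) fun h2 => hlt.ne' (τ.injective h2)
  have hmono : StrictMono (τ ∘ σ.symm) := fun i j hij => h' _ _ (by simpa using hij)
  have hid : τ ∘ σ.symm = id := by
    rw [← hmono.range_inj strictMono_id, Set.range_id,
      Function.Surjective.range_eq (τ.surjective.comp σ.symm.surjective)]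
  ext i
  simpa using congrArg Fin.val (congrFun hid (σ i)).symm

/-- Every injective sequence of length `n` has the order pattern of a permutation. -/
theorem exists_perm_lt_iff_lt {n : ℕ} (f : Fin n → ℕ) (hf : Function.Injective f) :
    ∃ σ : Equiv.Perm (Fin n), ∀ i j, σ i < σ j ↔ f i < f j := by
  have hmono : StrictMono (f ∘ Tuple.sort f) :=
    (Tuple.monotone_sort f).strictMono_of_injective (hf.comp (Tuple.sort f).injective)
  refine ⟨(Tuple.sort f).symm, fun i j => ?_⟩
  rw [← hmono.lt_iff_lt]
  simp

theorem SepColoring.comp {K L : Type*} {c : ℕ → ℕ → K} {a b : ℕ} (h : SepColoring c a b)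
    (g : K → L) : SepColoring (fun i j => g (c i j)) a b := by
  induction h with
  | single a => exact single a
  | split a l b s hal hlb hs hL hR ihL ihR =>
    exact split a l b (g s) hal hlb (fun i j h1 h2 h3 h4 => congrArg g (hs i j h1 h2 h3 h4)) ihL ihR

theorem exists_forall_lt_of_lt (f : ℕ → ℕ) (b : ℕ) : ∃ M, ∀ i < b, f i < M :=
  ⟨(Finset.range b).sup f + 1, fun _ hi =>
    Nat.lt_succ_of_le (Finset.le_sup (f := f) (Finset.mem_range.mpr hi))⟩

/-- A separable two-colouring is the pattern of ascents and descents of an integer sequence. -/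
theorem SepColoring.exists_realization {c : ℕ → ℕ → Bool} {a b : ℕ} (h : SepColoring c a b) :
    ∃ f : ℕ → ℕ, ∀ i j, a ≤ i → i < j → j < b →
      (c i j = true → f i < f j) ∧ (c i j = false → f j < f i) := by
  induction h with
  | single a => exact ⟨id, fun i j h1 h2 h3 => by omega⟩
  | split a l b s hal hlb hs hL hR ihL ihR =>
    obtain ⟨f, hf⟩ := ihL
    obtain ⟨g, hg⟩ := ihR
    obtain ⟨M, hM⟩ := exists_forall_lt_of_lt f l
    obtain ⟨N, hN⟩ := exists_forall_lt_of_lt g b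
    refine ⟨fun i => if i < l then f i + (if s then 0 else N) else g i + (if s then M else 0),
      fun i j h1 h2 h3 => ?_⟩
    by_cases hj : j < l
    · simpa [hj, h2.trans hj] using hf i j h1 h2 hj
    by_cases hi : l ≤ i
    · simpa [hj, hi.not_gt] using hg i j hi h2 h3
    · have h4 := hM i (by omega)
      have h5 := hN j h3
      rw [hs i j h1 (by omega) (by omega) h3]
      cases s <;> simp [hj, not_le.mp hi] <;> omega

end Realization

section Pattern

variable {e n : ℕ}

theorem dPermRows_of_lt {d : ℕ} (P : Fin d → Equiv.Perm (Fin n)) (r : Fin d) {j : ℕ} (hj : j < n) :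
    dPermRows P r j = P r ⟨j, hj⟩ := dif_pos hj

theorem dPermRows_ne {d : ℕ} (P : Fin d → Equiv.Perm (Fin n)) (r : Fin d) {i j : ℕ} (hij : i < j)
    (hj : j < n) : dPermRows P r i ≠ dPermRows P r j := by
  rw [dPermRows_of_lt P r hj, dPermRows_of_lt P r (hij.trans hj)]
  intro h
  exact hij.ne (congrArg Fin.val ((P r).injective (Fin.ext h)))

/-- The colouring of the pairs `i < j < n` recording which of the rows after the first ascend. -/
def ascentColoring (P : Fin (e + 1) → Equiv.Perm (Fin n)) (i j : ℕ) (r : Fin e) : Bool :=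
  decide (i < j ∧ j < n ∧ dPermRows P r.succ i < dPermRows P r.succ j)

theorem ascentColoring_eq_true {P : Fin (e + 1) → Equiv.Perm (Fin n)} {i j : ℕ} {r : Fin e}
    (hij : i < j) (hj : j < n) :
    ascentColoring P i j r = true ↔ dPermRows P r.succ i < dPermRows P r.succ j := by
  simp [ascentColoring, hij, hj]

theorem ascentColoring_eq_false {P : Fin (e + 1) → Equiv.Perm (Fin n)} {i j : ℕ} {r : Fin e}
    (hij : i < j) (hj : j < n) :
    ascentColoring P i j r = false ↔ dPermRows P r.succ j < dPermRows P r.succ i := by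
  rw [← Bool.not_eq_true, ascentColoring_eq_true hij hj, not_lt]
  exact ⟨fun h => lt_of_le_of_ne h (dPermRows_ne P _ hij hj).symm, le_of_lt⟩

theorem SepOn.sepColoring {P : Fin (e + 1) → Equiv.Perm (Fin n)} {a b : ℕ}
    (h : SepOn (dPermRows P) a b) (hb : b ≤ n) : SepColoring (ascentColoring P) a b := by
  induction h with
  | single a => exact .single a
  | split a l b hal hlb hmono hL hR ihL ihR =>
    refine .split a l b (ascentColoring P a (b - 1)) hal hlb (fun i j h1 h2 h3 h4 => ?_)
      (ihL (by omega)) (ihR hb)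
    ext r
    rcases hmono r.succ with hlt | hlt
    · rw [(ascentColoring_eq_true (by omega) (by omega)).mpr (hlt i j h1 h2 h3 h4),
        (ascentColoring_eq_true (by omega) (by omega)).mpr
          (hlt a (b - 1) le_rfl hal (by omega) (by omega))]
    · rw [(ascentColoring_eq_false (by omega) (by omega)).mpr (hlt i j h1 h2 h3 h4),
        (ascentColoring_eq_false (by omega) (by omega)).mpr
          (hlt a (b - 1) le_rfl hal (by omega) (by omega))]

theorem SepColoring.sepOn {P : Fin (e + 1) → Equiv.Perm (Fin n)} (hP : P 0 = 1) {a b : ℕ}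
    (h : SepColoring (ascentColoring P) a b) (hb : b ≤ n) : SepOn (dPermRows P) a b := by
  induction h with
  | single a => exact .single a
  | split a l b s hal hlb hs hL hR ihL ihR =>
    refine .split a l b hal hlb (fun r => ?_) (ihL (by omega)) (ihR hb)
    cases r using Fin.cases with
    | zero =>
      left
      intro i j h1 h2 h3 h4
      rw [dPermRows_of_lt P 0 (by omega : i < n), dPermRows_of_lt P 0 (by omega : j < n), hP]
      exact h2.trans_le h3
    | succ r =>
      cases hsr : s r with
      | true =>
        left
        intro i j h1 h2 h3 h4
        rw [← ascentColoring_eq_true (by omega) (by omega), hs i j h1 h2 h3 h4, hsr]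
      | false =>
        right
        intro i j h1 h2 h3 h4
        rw [← ascentColoring_eq_false (by omega) (by omega), hs i j h1 h2 h3 h4, hsr]

theorem card_isSepDPerm (e n : ℕ) :
    Nat.card {P : Fin (e + 1) → Equiv.Perm (Fin n) // IsDPerm P ∧ IsSepDPerm P} =
      Nat.card (sepColorings (Fin e → Bool) 0 n) := by
  let f : {P : Fin (e + 1) → Equiv.Perm (Fin n) // IsDPerm P ∧ IsSepDPerm P} →
      sepColorings (Fin e → Bool) 0 n := fun P =>
    ⟨ascentColoring P.1, SepOn.sepColoring P.2.2 le_rfl, fun i j hij => by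
      ext r
      have : ¬(i < j ∧ j < n ∧ dPermRows P.1 r.succ i < dPermRows P.1 r.succ j) :=
        fun h => hij ⟨Nat.zero_le i, h.1, h.2.1⟩
      simpa [ascentColoring] using this⟩
  refine Nat.card_congr (Equiv.ofBijective f ⟨?_, ?_⟩)
  · rintro ⟨P, hP, hPs⟩ ⟨Q, hQ, hQs⟩ heq
    have hPQ : ascentColoring P = ascentColoring Q := congrArg Subtype.val heq
    refine Subtype.ext (funext fun r => ?_)
    change P r = Q r
    cases r using Fin.cases with
    | zero => exact (hP e.succ_pos).trans (hQ e.succ_pos).symm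
    | succ r =>
      refine Equiv.Perm.eq_of_lt_iff_lt fun i j hij => ?_
      have h1 := ascentColoring_eq_true (P := P) (r := r) hij j.2
      rw [hPQ, ascentColoring_eq_true hij j.2] at h1
      simpa only [dPermRows_of_lt _ _ i.2, dPermRows_of_lt _ _ j.2, Fin.eta, Fin.val_fin_lt]
        using h1.symm
  · rintro ⟨c, hc, hsupp⟩
    have hrow (r : Fin e) : ∃ σ : Equiv.Perm (Fin n), ∀ i j : Fin n, i < j →
        (σ i < σ j ↔ c i j r = true) := by
      obtain ⟨g, hg⟩ := (hc.comp fun s => s r).exists_realization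
      have hg' (i j : Fin n) (hij : i < j) := hg i j (Nat.zero_le _) hij j.2
      have hne (i j : Fin n) (hij : i < j) : g i ≠ g j := by
        have := hg' i j hij
        cases h : c i j r
        · exact (this.2 h).ne'
        · exact (this.1 h).ne
      obtain ⟨σ, hσ⟩ := exists_perm_lt_iff_lt (fun i : Fin n => g i) fun i j hij => by
        rcases lt_trichotomy i j with h | h | h
        · exact absurd hij (hne i j h)
        · exact h
        · exact absurd hij.symm (hne j i h)
      refine ⟨σ, fun i j hij => (hσ i j).trans ⟨fun h => ?_, (hg' i j hij).1⟩⟩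
      by_contra hfalse
      exact lt_asymm h ((hg' i j hij).2 (by simpa using hfalse))
    choose σ hσ using hrow
    let P : Fin (e + 1) → Equiv.Perm (Fin n) := Fin.cons 1 σ
    have hPc : ascentColoring P = c := by
      ext i j r
      by_cases hij : i < j ∧ j < n
      · rw [Bool.eq_iff_iff, ascentColoring_eq_true hij.1 hij.2, dPermRows_of_lt _ _ hij.2,
          dPermRows_of_lt _ _ (hij.1.trans hij.2)]
        exact hσ r ⟨i, hij.1.trans hij.2⟩ ⟨j, hij.2⟩ hij.1
      · rw [hsupp i j fun h => hij h.2]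
        have : ¬(i < j ∧ j < n ∧ dPermRows P r.succ i < dPermRows P r.succ j) :=
          fun h => hij ⟨h.1, h.2.1⟩
        simpa [ascentColoring] using this
    have hP0 : P 0 = 1 := rfl
    exact ⟨⟨P, fun _ => hP0, SepColoring.sepOn hP0 (by rwa [hPc]) le_rfl⟩, Subtype.ext hPc⟩

end Pattern

/-- Explicit formula for the number of separable d-permutations of `[n]`, `n > 1`. -/
theorem sep_dPerm_explicit (d n : ℕ) (hd : 1 ≤ d) (hn : 1 < n) :
    (Nat.card {P : Fin d → Equiv.Perm (Fin n) // IsDPerm P ∧ IsSepDPerm P} : ℚ) =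
      (1 / ((n : ℚ) - 1)) * ∑ k ∈ Finset.range (n - 1),
        (Nat.choose (n - 1) k : ℚ) * (Nat.choose (n - 1) (k + 1) : ℚ) *
          ((2 ^ (d - 1) - 1 : ℕ) : ℚ) ^ k * ((2 : ℚ) ^ (d - 1)) ^ (n - k - 1) := by
  obtain ⟨e, rfl⟩ : ∃ e, d = e + 1 := ⟨d - 1, by omega⟩
  obtain ⟨m, rfl⟩ : ∃ m, n = m + 2 := ⟨n - 2, by omega⟩
  obtain ⟨q, hq⟩ : ∃ q, 2 ^ e = q + 1 := ⟨2 ^ e - 1, by have := Nat.one_le_two_pow (n := e); omega⟩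
  have hqQ : (2 : ℚ) ^ e = q + 1 := by exact_mod_cast hq
  have hK : Nat.card (Fin e → Bool) = q + 1 := by simp [hq]
  have hB := explicit_of_recurrence q
    (fun k => (Nat.card (sepColorings (Fin e → Bool) 0 (k + 1)) : ℚ))
    (by exact_mod_cast card_sepColorings_single (K := Fin e → Bool) 0)
    (fun k => by exact_mod_cast card_sepColorings_recurrence q hK k) m
  rw [card_isSepDPerm, show m + 2 = m + 1 + 1 from rfl, hB]
  simp only [Nat.add_sub_cancel, hq, hqQ]
  push_cast
  congr 1
  · ring
  · refine Finset.sum_congr rfl fun k _ => ?_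
    rw [show m + 1 + 1 - k - 1 = m + 1 - k by omega]
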